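/- arXiv:2106.07300 — 2 statements merged into one kernel-verified Lean document; each statement's English description precedes it below -/
import Mathlib

section
/- Let I be an ordered instance of fair allocation under cardinality constraints with n ≥ 2 agents and |C_h| ≤ n·k_h for all h, let j ∈ M, and let B consist of j together with, for each category C_h, the max(0, |C_h \ {j}| − (n−1)·k_h) items of C_h \ {j} of least value. Then for every agent i', the maximin share of i' in the reduced instance I' (items M \ B, n−1 agents, same categories and thresholds restricted to M \ B) is at least the maximin share of i' in I. -/
open Finset

/-- A partition of all items into `n` (possibly empty) bundles: every item
belongs to exactly one bundle. -/
def IsPartition {M : Type*} {n : ℕ} (A : Fin n → Finset M) : Prop :=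
  ∀ j : M, ∃! i, j ∈ A i

/-- A bundle is feasible if it contains at most `k h` items from each category `h`. -/
def FeasibleBundle {M : Type*} {ℓ : ℕ} (cat : M → Fin ℓ) (k : Fin ℓ → ℕ)
    (B : Finset M) : Prop :=
  ∀ h, (B.filter (fun j => cat j = h)).card ≤ k h

/-- A feasible allocation: a partition of the items into `n` feasible bundles. -/
def FeasibleAlloc {M : Type*} {n ℓ : ℕ} (cat : M → Fin ℓ) (k : Fin ℓ → ℕ)
    (A : Fin n → Finset M) : Prop :=
  IsPartition A ∧ ∀ i, FeasibleBundle cat k (A i)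

/-- The maximin share of an agent with additive valuation given by item values `v`,
in the instance with `n` agents, categories `cat` and thresholds `k`. -/
noncomputable def mms (n : ℕ) {M : Type*} {ℓ : ℕ} (cat : M → Fin ℓ)
    (k : Fin ℓ → ℕ) (v : M → ℝ) : ℝ :=
  sSup {x | ∃ A : Fin n → Finset M, FeasibleAlloc cat k A ∧ x = ⨅ i, ∑ j ∈ A i, v j}

/-- A partial assignment of items to `p` agents that respects the thresholds extends to a full one
as soon as the total capacity of every category suffices. -/
theorem exists_extend_assignment {X : Type*} [Fintype X] [DecidableEq X] {ℓ p : ℕ}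
    (cat : X → Fin ℓ) (k : Fin ℓ → ℕ)
    (hcap : ∀ h, #{x | cat x = h} ≤ p * k h) (S : Finset X) (g : X → Fin p)
    (hg : ∀ i h, #{x ∈ S | g x = i ∧ cat x = h} ≤ k h) :
    ∃ g' : X → Fin p, (∀ x ∈ S, g' x = g x) ∧ ∀ i h, #{x | g' x = i ∧ cat x = h} ≤ k h := by
  induction hc : #Sᶜ generalizing S g with
  | zero =>
    have hS : S = univ := by simpa using hc
    subst hS
    exact ⟨g, fun _ _ => rfl, hg⟩
  | succ c ih =>
    obtain ⟨x, hx⟩ : Sᶜ.Nonempty := by rw [← card_pos]; omega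
    have hxS : x ∉ S := by simpa using hx
    obtain ⟨i, hi⟩ : ∃ i, #{y ∈ S | g y = i ∧ cat y = cat x} < k (cat x) := by
      by_contra! hfull
      have hlt : #{y ∈ S | cat y = cat x} < #{y | cat y = cat x} := by
        refine card_lt_card ((ssubset_iff_of_subset ?_).2 ⟨x, by simp, by simp [hxS]⟩)
        exact filter_subset_filter _ (subset_univ _)
      have hsum : #{y ∈ S | cat y = cat x} = ∑ i, #{y ∈ S | g y = i ∧ cat y = cat x} := by
        rw [card_eq_sum_card_fiberwise (f := g) (t := univ) (fun _ _ => by simp)]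
        refine sum_congr rfl fun i _ => ?_
        rw [filter_filter]
        simp only [and_comm]
      have hge : ∑ _i : Fin p, k (cat x) ≤ ∑ i, #{y ∈ S | g y = i ∧ cat y = cat x} :=
        sum_le_sum fun i _ => hfull i
      simp only [sum_const, card_univ, Fintype.card_fin, smul_eq_mul] at hge
      have := hcap (cat x)
      omega
    have hne : ∀ y ∈ S, y ≠ x := fun y hy h => hxS (h ▸ hy)
    have hold : ∀ i' h, {y ∈ S | Function.update g x i y = i' ∧ cat y = h} =
        {y ∈ S | g y = i' ∧ cat y = h} := fun i' h =>
      filter_congr fun y hy => by rw [Function.update_of_ne (hne y hy)]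
    obtain ⟨g', hg'S, hg'⟩ := ih (insert x S) (Function.update g x i) (fun i' h => by
      rw [filter_insert, hold]
      split_ifs with hcond
      · obtain ⟨h1, h2⟩ := hcond
        rw [Function.update_self] at h1
        subst h1 h2
        exact (card_insert_le _ _).trans hi
      · exact hg i' h) (by rw [compl_insert, card_erase_of_mem hx]; omega)
    refine ⟨g', fun y hy => ?_, hg'⟩
    rw [hg'S y (mem_insert_of_mem hy), Function.update_of_ne (hne y hy)]

/-- Fiberwise cardinality bounds give an injection commuting with the map to the base. -/
theorem exists_injOn_preserving {X Y : Type*} (cat : X → Y) [DecidableEq Y]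
    (S T : Finset X) (h : ∀ c, #{x ∈ S | cat x = c} ≤ #{x ∈ T | cat x = c}) :
    ∃ ψ : X → X, (∀ x ∈ S, ψ x ∈ T ∧ cat (ψ x) = cat x) ∧ Set.InjOn ψ S := by
  have hemb : ∀ c, Nonempty ({x // x ∈ S.filter (cat · = c)} ↪ {x // x ∈ T.filter (cat · = c)}) :=
    fun c => Function.Embedding.nonempty_of_card_le (by simpa only [Fintype.card_coe] using h c)
  let e := fun c => (hemb c).some
  classical
  let ψ : X → X := fun x => if hx : x ∈ S then e (cat x) ⟨x, mem_filter.2 ⟨hx, rfl⟩⟩ else x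
  have hψ : ∀ x (hx : x ∈ S), ψ x = e (cat x) ⟨x, mem_filter.2 ⟨hx, rfl⟩⟩ :=
    fun x hx => dif_pos hx
  have hmem : ∀ x ∈ S, ψ x ∈ T ∧ cat (ψ x) = cat x := fun x hx => by
    rw [hψ x hx]
    exact mem_filter.1 (e (cat x) ⟨x, mem_filter.2 ⟨hx, rfl⟩⟩).2
  refine ⟨ψ, hmem, fun x hx y hy hxy => ?_⟩
  have hcat : cat y = cat x := by rw [← (hmem x hx).2, ← (hmem y hy).2, hxy]
  have he : ∀ c (hc : cat y = c), ψ y = e c ⟨y, mem_filter.2 ⟨hy, hc⟩⟩ := by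
    rintro _ rfl
    exact hψ y hy
  rw [hψ x hx, he _ hcat] at hxy
  simpa using (e (cat x)).injective (Subtype.ext hxy)

/-- The owner function of a partition into bundles. -/
theorem IsPartition.exists_owner {M : Type*} {n : ℕ} {A : Fin n → Finset M} (hA : IsPartition A) :
    ∃ f : M → Fin n, ∀ x i, x ∈ A i ↔ f x = i := by
  choose f hf hu using hA
  exact ⟨f, fun x i => ⟨fun h => (hu x i h).symm, fun h => h ▸ hf x⟩⟩

/-- The set of guaranteed values of allocations is bounded above. -/
theorem bddAbove_mms {M : Type*} [Finite M] {n ℓ : ℕ} (cat : M → Fin ℓ) (k : Fin ℓ → ℕ)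
    (v : M → ℝ) :
    BddAbove {x | ∃ A : Fin n → Finset M, FeasibleAlloc cat k A ∧ x = ⨅ i, ∑ j ∈ A i, v j} := by
  refine ((Set.finite_range fun A : Fin n → Finset M => ⨅ i, ∑ j ∈ A i, v j).subset ?_).bddAbove
  rintro x ⟨A, -, rfl⟩
  exact ⟨A, rfl⟩

theorem mms_nonneg {M : Type*} {n ℓ : ℕ} (cat : M → Fin ℓ) (k : Fin ℓ → ℕ) (v : M → ℝ)
    (hv : ∀ j, 0 ≤ v j) : 0 ≤ mms n cat k v := by
  refine Real.sSup_nonneg ?_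
  rintro x ⟨A, -, rfl⟩
  exact Real.iInf_nonneg fun i => sum_nonneg fun j _ => hv j

/-- A category-preserving, value-nondecreasing injection of the items outside the bundle `A a` into
another item set with enough total capacity yields an allocation of that set to the other agents in
which every bundle is worth at least as much as before. -/
theorem exists_feasibleAlloc_of_injective {M D : Type*} [Fintype M] [Fintype D] {ℓ p : ℕ}
    (hp : 0 < p) (cat : M → Fin ℓ) (catD : D → Fin ℓ) (k : Fin ℓ → ℕ) (w : M → ℝ) (wD : D → ℝ)
    (hwD : ∀ y, 0 ≤ wD y) {A : Fin (p + 1) → Finset M} (hA : FeasibleAlloc cat k A)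
    (a : Fin (p + 1)) (φ : {x // x ∉ A a} → D) (hφ : Function.Injective φ)
    (hφcat : ∀ x, catD (φ x) = cat x) (hφw : ∀ x : {x // x ∉ A a}, w x ≤ wD (φ x))
    (hcap : ∀ h, #{y | catD y = h} ≤ p * k h) :
    ∃ A' : Fin p → Finset D, FeasibleAlloc catD k A' ∧
      ∀ i, ∑ x ∈ A (a.succAbove i), w x ≤ ∑ y ∈ A' i, wD y := by
  classical
  obtain ⟨f, hf⟩ := hA.1.exists_owner
  have ho : ∀ x : {x // x ∉ A a}, ∃ i, a.succAbove i = f x := fun x =>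
    Fin.exists_succAbove_eq fun h => x.2 ((hf x a).2 h)
  choose o ho using ho
  have hoA : ∀ x i, o x = i → (x : M) ∈ A (a.succAbove i) := fun x i h =>
    (hf x _).2 (by rw [← ho x, h])
  obtain ⟨g, hgS, hg⟩ := exists_extend_assignment catD k hcap (univ.image φ)
    (Function.extend φ o fun _ => ⟨0, hp⟩) (fun i h => by
      refine le_trans ?_ (hA.2 (a.succAbove i) h)
      rw [filter_image, card_image_of_injective _ hφ,
        ← card_image_of_injective _ Subtype.val_injective]
      refine card_le_card fun x hx => ?_
      obtain ⟨z, hz, rfl⟩ := mem_image.1 hx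
      rw [mem_filter, hφ.extend_apply, hφcat] at hz
      exact mem_filter.2 ⟨hoA z i hz.2.1, hz.2.2⟩)
  have hgφ : ∀ x, g (φ x) = o x := fun x => by
    rw [hgS _ (mem_image_of_mem _ (mem_univ _)), hφ.extend_apply]
  refine ⟨fun i => {y | g y = i}, ⟨fun y => ⟨g y, by simp, by simp⟩, fun i h => ?_⟩, fun i => ?_⟩
  · rw [filter_filter]
    exact hg i h
  · have hout : ∀ x ∈ A (a.succAbove i), x ∉ A a := fun x hx hxa =>
      Fin.succAbove_ne a i (((hf x _).1 hx).symm.trans ((hf x a).1 hxa))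
    calc ∑ x ∈ A (a.succAbove i), w x
        = ∑ x ∈ (A (a.succAbove i)).subtype (· ∉ A a), w x := by
          rw [sum_subtype_of_mem _ hout]
      _ ≤ ∑ x ∈ (A (a.succAbove i)).subtype (· ∉ A a), wD (φ x) := sum_le_sum fun x _ => hφw x
      _ = ∑ y ∈ ((A (a.succAbove i)).subtype (· ∉ A a)).image φ, wD y :=
          (sum_image hφ.injOn).symm
      _ ≤ _ := by
          refine sum_le_sum_of_subset_of_nonneg (fun y hy => ?_) fun y _ _ => hwD y
          obtain ⟨x, hx, rfl⟩ := mem_image.1 hy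
          rw [mem_subtype, hf, ← ho x] at hx
          simpa [hgφ] using Fin.succAbove_right_injective hx

/-- The items of a category outside one bundle of a feasible allocation fit into the other ones. -/
theorem FeasibleAlloc.card_filter_notMem_le {M : Type*} [Fintype M] [DecidableEq M] {ℓ p : ℕ}
    {cat : M → Fin ℓ} {k : Fin ℓ → ℕ} {A : Fin (p + 1) → Finset M} (hA : FeasibleAlloc cat k A)
    (a : Fin (p + 1)) (h : Fin ℓ) : #{x | cat x = h ∧ x ∉ A a} ≤ p * k h := by
  have hsub : ({x | cat x = h ∧ x ∉ A a} : Finset M) ⊆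
      univ.biUnion fun i : Fin p => (A (a.succAbove i)).filter (cat · = h) := fun x hx => by
    obtain ⟨hxh, hxa⟩ := (mem_filter.1 hx).2
    obtain ⟨i, hi, -⟩ := hA.1 x
    obtain ⟨i', rfl⟩ := Fin.exists_succAbove_eq (x := i) (y := a) (by rintro rfl; exact hxa hi)
    exact mem_biUnion.2 ⟨i', mem_univ _, mem_filter.2 ⟨hi, hxh⟩⟩
  refine (card_le_card hsub).trans ?_
  simpa using card_biUnion_le_card_mul (univ : Finset (Fin p)) _ (k h)
    fun i _ => hA.2 (a.succAbove i) h

/-- In an ordered instance, removing an item `j` together with, for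
each category `h`, the `max (0, |C_h \ {j}| - (n-1)·k h)` least valuable items of
`C_h \ {j}`, and one agent, does not decrease the maximin share of any agent. -/
theorem stmt_9 {m ℓ n : ℕ} (hn : 2 ≤ n)
    (cat : Fin m → Fin ℓ) (k : Fin ℓ → ℕ)
    (v : Fin n → Fin m → ℝ) (hv : ∀ i j, 0 ≤ v i j)
    (hord : ∀ j j', cat j = cat j' →
      (∀ i, v i j ≤ v i j') ∨ (∀ i, v i j' ≤ v i j))
    (hcard : ∀ h, (univ.filter (fun x => cat x = h)).card ≤ n * k h)
    (j : Fin m) (B : Finset (Fin m)) (hjB : j ∈ B)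
    (hBcard : ∀ h, ((B.erase j).filter (fun x => cat x = h)).card =
      (((univ.filter (fun x => cat x = h)).erase j)).card - (n - 1) * k h)
    (hBlow : ∀ x ∈ B.erase j, ∀ y, y ∉ B → y ≠ j → cat y = cat x →
      ∀ i', v i' x ≤ v i' y) :
    ∀ i', mms n cat k (v i') ≤
      mms (n - 1) (fun x : {x : Fin m // x ∉ B} => cat x.1) k (fun x => v i' x.1) := by
  intro i'
  obtain ⟨p, rfl⟩ : ∃ p, n = p + 1 := ⟨n - 1, by omega⟩
  simp only [Nat.add_sub_cancel] at hBcard ⊢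
  have hp : 0 < p := by omega
  have : Nonempty (Fin p) := ⟨⟨0, hp⟩⟩
  refine Real.sSup_le ?_ (mms_nonneg _ _ _ fun x => hv i' x)
  rintro _ ⟨A, hA, rfl⟩
  obtain ⟨a, haj, -⟩ := hA.1 j
  have hcap : ∀ h, #{y : {x : Fin m // x ∉ B} | cat y.1 = h} ≤ p * k h := fun h => by
    rw [← card_image_of_injective _ Subtype.val_injective]
    have hsub : image Subtype.val {y : {x : Fin m // x ∉ B} | cat y.1 = h} ⊆
        (univ.filter (cat · = h)).erase j \ (B.erase j).filter (cat · = h) := fun x hx => by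
      obtain ⟨z, hz, rfl⟩ := mem_image.1 hx
      have hzj : z.1 ≠ j := fun e => z.2 (e ▸ hjB)
      have := z.2
      simp_all
    have hsub' : (B.erase j).filter (cat · = h) ⊆ (univ.filter (cat · = h)).erase j := by
      intro x
      simp only [mem_filter, mem_erase, mem_univ, true_and]
      tauto
    have h1 := card_le_card hsub
    rw [card_sdiff_of_subset hsub', hBcard] at h1
    omega
  have hswap : ∀ h, #{x ∈ B \ A a | cat x = h} ≤ #{x ∈ A a \ B | cat x = h} := fun h => by
    have h1 : #((univ.filter (cat · = h)).erase j) ≤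
        #((A a).erase j |>.filter (cat · = h)) + #{x | cat x = h ∧ x ∉ A a} := by
      refine (card_le_card fun x hx => ?_).trans (card_union_le _ _)
      simp only [mem_union, mem_filter, mem_erase, mem_univ, true_and] at hx ⊢
      tauto
    have h2 := hA.card_filter_notMem_le a h
    have h3 : #((B.erase j).filter (cat · = h)) ≤ #(((A a).erase j).filter (cat · = h)) := by
      rw [hBcard]
      omega
    convert card_sdiff_le_card_sdiff_iff.2 h3 using 2 <;>
    · ext x
      by_cases hx : x = j
      · subst hx
        simp [hjB, haj]
      · simp only [mem_filter, mem_sdiff, mem_erase]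
        tauto
  obtain ⟨ψ, hψ, hψinj⟩ := exists_injOn_preserving cat _ _ hswap
  have hψT : ∀ x ∈ B, x ∉ A a → ψ x ∈ A a ∧ ψ x ∉ B ∧ cat (ψ x) = cat x := fun x hx hxa => by
    have := hψ x (mem_sdiff.2 ⟨hx, hxa⟩)
    exact ⟨(mem_sdiff.1 this.1).1, (mem_sdiff.1 this.1).2, this.2⟩
  let φ : {x // x ∉ A a} → {x : Fin m // x ∉ B} := fun x =>
    if hx : x.1 ∈ B then ⟨ψ x, (hψT x hx x.2).2.1⟩ else ⟨x, hx⟩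
  have hφ₁ : ∀ x, x.1 ∈ B → (φ x).1 = ψ x := fun x hx => by simp [φ, hx]
  have hφ₂ : ∀ x, x.1 ∉ B → (φ x).1 = x := fun x hx => by simp [φ, hx]
  have hφinj : Function.Injective φ := fun x y hxy => by
    have hval := congrArg Subtype.val hxy
    by_cases hx : x.1 ∈ B <;> by_cases hy : y.1 ∈ B
    · rw [hφ₁ x hx, hφ₁ y hy] at hval
      exact Subtype.ext (hψinj (mem_sdiff.2 ⟨hx, x.2⟩) (mem_sdiff.2 ⟨hy, y.2⟩) hval)
    · rw [hφ₁ x hx, hφ₂ y hy] at hval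
      exact (y.2 (hval ▸ (hψT x hx x.2).1)).elim
    · rw [hφ₂ x hx, hφ₁ y hy] at hval
      exact (x.2 (hval ▸ (hψT y hy y.2).1)).elim
    · rw [hφ₂ x hx, hφ₂ y hy] at hval
      exact Subtype.ext hval
  have hφcat : ∀ x, cat (φ x).1 = cat x := fun x => by
    by_cases hx : x.1 ∈ B
    · rw [hφ₁ x hx, (hψT x hx x.2).2.2]
    · rw [hφ₂ x hx]
  have hφw : ∀ x : {x // x ∉ A a}, v i' x ≤ v i' (φ x).1 := fun x => by
    by_cases hx : x.1 ∈ B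
    · exact hBlow x (mem_erase.2 ⟨fun e => x.2 (e ▸ haj), hx⟩) _ (φ x).2
        (fun e => (φ x).2 (e ▸ hjB)) (hφcat x) i'
    · rw [hφ₂ x hx]
  obtain ⟨A', hA', hle⟩ := exists_feasibleAlloc_of_injective hp cat
    (fun x : {x : Fin m // x ∉ B} => cat x.1) k (v i') (fun x => v i' x.1) (fun y => hv i' y)
    hA a φ hφinj hφcat hφw hcap
  refine le_trans (le_ciInf fun i => ?_) (le_csSup (bddAbove_mms _ _ _) ⟨A', hA', rfl⟩)
  exact (ciInf_le (Set.finite_range _).bddBelow (a.succAbove i)).trans (hle i)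
end

section
/- Let I be an instance of fair allocation under cardinality constraints with |C_h| ≤ n·k_h for every category h, such that v_i(M) = n for every agent i and v_i({j}) < 1/2 for every agent i and every item j. Then there exists a feasible allocation A = (A_1, …, A_n) with v_i(A_i) ≥ 1/2 for every agent i. -/
open Finset

/-- Any finset has a subset of each admissible size that is initial with respect to `f`. -/
theorem exists_initial_subset {M γ : Type*} [DecidableEq M] [LinearOrder γ] (f : M → γ)
    (S : Finset M) (b : ℕ) (hb : b ≤ S.card) :
    ∃ L ⊆ S, L.card = b ∧ ∀ x ∈ L, ∀ y ∈ S \ L, f x ≤ f y := by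
  induction b with
  | zero => exact ⟨∅, by simp, by simp, by simp⟩
  | succ b ih =>
    obtain ⟨L, hLS, hLb, hL⟩ := ih (by omega)
    have hne : (S \ L).Nonempty := by
      rw [← card_pos, card_sdiff_of_subset hLS]
      omega
    obtain ⟨z, hz, hmin⟩ := exists_min_image (S \ L) f hne
    have hz' := mem_sdiff.1 hz
    refine ⟨insert z L, insert_subset hz'.1 hLS, by rw [card_insert_of_notMem hz'.2, hLb], ?_⟩
    intro x hx y hy
    have hy' : y ∈ S \ L := by
      simp only [mem_sdiff, mem_insert, not_or] at hy ⊢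
      exact ⟨hy.1, hy.2.2⟩
    rcases mem_insert.1 hx with rfl | hx
    · exact hmin y hy'
    · exact hL x hx y hy'

/-- If every element of `X` is worth at most every element of `Y`, weighted cardinality bounds
transfer to weighted sums. -/
theorem mul_sum_le_mul_sum_of_card {M : Type*} (w : M → ℝ) (hw : ∀ j, 0 ≤ w j)
    (X Y : Finset M) (p q : ℕ) (hcard : p * X.card ≤ q * Y.card)
    (hXY : ∀ x ∈ X, ∀ y ∈ Y, w x ≤ w y) :
    (p : ℝ) * ∑ j ∈ X, w j ≤ q * ∑ j ∈ Y, w j := by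
  have hq : (0 : ℝ) ≤ q * ∑ j ∈ Y, w j :=
    mul_nonneg (Nat.cast_nonneg q) (sum_nonneg fun j _ => hw j)
  rcases X.eq_empty_or_nonempty with rfl | hX
  · simpa using hq
  rcases Y.eq_empty_or_nonempty with rfl | hY
  · have hp : p = 0 := by
      have := card_pos.2 hX
      simp only [card_empty, mul_zero, Nat.le_zero, mul_eq_zero] at hcard
      omega
    simp [hp]
  obtain ⟨y, hy, hmin⟩ := exists_min_image Y w hY
  have h1 : ∑ j ∈ X, w j ≤ X.card * w y := by
    simpa using sum_le_card_nsmul X w (w y) fun x hx => hXY x hx y hy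
  have h2 : Y.card * w y ≤ ∑ j ∈ Y, w j := by
    simpa using card_nsmul_le_sum Y w (w y) hmin
  calc (p : ℝ) * ∑ j ∈ X, w j ≤ p * (X.card * w y) := by gcongr
    _ = ((p * X.card : ℕ) : ℝ) * w y := by push_cast; ring
    _ ≤ ((q * Y.card : ℕ) : ℝ) * w y :=
        mul_le_mul_of_nonneg_right (by exact_mod_cast hcard) (hw y)
    _ = q * (Y.card * w y) := by push_cast; ring
    _ ≤ q * ∑ j ∈ Y, w j := by gcongr

/-- Choosing an initial subset of prescribed size in every category. -/
theorem exists_initial_subset_of_categories {M γ : Type*} [DecidableEq M] [LinearOrder γ] {ℓ : ℕ}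
    (f : M → γ) (cat : M → Fin ℓ) (S : Finset M) (b : Fin ℓ → ℕ)
    (hb : ∀ h, b h ≤ (S.filter (fun j => cat j = h)).card) :
    ∃ L ⊆ S, (∀ h, (L.filter (fun j => cat j = h)).card = b h) ∧
      ∀ x ∈ L, ∀ y ∈ S \ L, cat x = cat y → f x ≤ f y := by
  choose L hLS hLb hL using fun h => exists_initial_subset f _ (b h) (hb h)
  refine ⟨S.filter (fun j => j ∈ L (cat j)), filter_subset _ _, fun h => ?_, ?_⟩
  · rw [← hLb h]
    congr 1
    ext j
    have := @hLS h j
    simp only [mem_filter] at this ⊢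
    constructor
    · rintro ⟨⟨-, h1⟩, rfl⟩
      exact h1
    · intro hj
      obtain ⟨h1, rfl⟩ := this hj
      exact ⟨⟨h1, hj⟩, rfl⟩
  · intro x hx y hy hxy
    simp only [mem_filter, mem_sdiff, not_and] at hx hy
    refine hL (cat x) x hx.2 y ?_
    simp only [mem_filter, mem_sdiff]
    exact ⟨⟨hy.1, hxy.symm⟩, hxy ▸ hy.2 hy.1⟩

/-- Categorywise version of `mul_sum_le_mul_sum_of_card`. -/
theorem mul_sum_le_mul_sum_of_categories {M : Type*} {ℓ : ℕ} (w : M → ℝ) (hw : ∀ j, 0 ≤ w j)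
    (cat : M → Fin ℓ) (X Y : Finset M) (p q : ℕ)
    (hcard : ∀ h, p * (X.filter (fun j => cat j = h)).card ≤
      q * (Y.filter (fun j => cat j = h)).card)
    (hXY : ∀ x ∈ X, ∀ y ∈ Y, cat x = cat y → w x ≤ w y) :
    (p : ℝ) * ∑ j ∈ X, w j ≤ q * ∑ j ∈ Y, w j := by
  rw [← sum_fiberwise X cat w, ← sum_fiberwise Y cat w, mul_sum, mul_sum]
  refine sum_le_sum fun h _ => mul_sum_le_mul_sum_of_card w hw _ _ p q (hcard h) ?_
  intro x hx y hy
  rw [mem_filter] at hx hy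
  exact hXY x hx.1 y hy.1 (hx.2.trans hy.2.symm)

theorem card_filter_sdiff_add {M : Type*} [DecidableEq M] (P : M → Prop) [DecidablePred P]
    {B S : Finset M} (h : B ⊆ S) :
    ((S \ B).filter P).card + (B.filter P).card = (S.filter P).card := by
  rw [← card_union_of_disjoint, ← filter_union, sdiff_union_of_subset h]
  exact disjoint_filter_filter sdiff_disjoint

/-- In an ordered instance, bag filling finds a bundle for one agent whose removal leaves
a valid instance for the other agents. -/
theorem exists_bag {M ι : Type*} [LinearOrder M] {ℓ : ℕ} (cat : M → Fin ℓ) (k : Fin ℓ → ℕ)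
    (w : ι → M → ℝ) (hw : ∀ i j, 0 ≤ w i j) (hsmall : ∀ i j, w i j < 1 / 2)
    (hanti : ∀ i x y, cat x = cat y → x ≤ y → w i y ≤ w i x)
    (T : Finset ι) (N : ℕ) (hT : T.Nonempty) (S : Finset M)
    (hcard : ∀ h, (S.filter (fun j => cat j = h)).card ≤ (N + 1) * k h)
    (hval : ∀ i ∈ T, (N : ℝ) + 1 ≤ ∑ j ∈ S, w i j) :
    ∃ B ⊆ S, ∃ i ∈ T, FeasibleBundle cat k B ∧
      (∀ h, ((S \ B).filter (fun j => cat j = h)).card ≤ N * k h) ∧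
      1 / 2 ≤ ∑ j ∈ B, w i j ∧ ∀ i' ∈ T, i' ≠ i → (N : ℝ) ≤ ∑ j ∈ S \ B, w i' j := by
  classical
  obtain ⟨L, hLS, hLc, hL⟩ := exists_initial_subset_of_categories OrderDual.toDual cat S
    (fun h => (S.filter (fun j => cat j = h)).card - N * k h) (fun h => Nat.sub_le _ _)
  obtain ⟨U, hUS, hUc, hU⟩ := exists_initial_subset_of_categories id cat S
    (fun h => min (S.filter (fun j => cat j = h)).card (k h)) (fun h => min_le_left _ _)
  have hsplit : ∀ i, ∀ B ⊆ S, ∑ j ∈ S \ B, w i j + ∑ j ∈ B, w i j = ∑ j ∈ S, w i j :=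
    fun i B hB => sum_sdiff hB
  have hLval : ∀ i, (N : ℝ) * ∑ j ∈ L, w i j ≤ ((1 : ℕ) : ℝ) * ∑ j ∈ S \ L, w i j := by
    intro i
    refine mul_sum_le_mul_sum_of_categories (w i) (hw i) cat L (S \ L) N 1 (fun h => ?_)
      fun x hx y hy hxy => hanti i y x hxy.symm (hL x hx y hy hxy)
    have h1 := card_filter_sdiff_add (fun j => cat j = h) hLS
    have h2 := hLc h
    have h3 := hcard h
    rcases Nat.eq_zero_or_pos (L.filter (fun j => cat j = h)).card with h0 | h0
    · simp [h0]
    have h4 : (L.filter (fun j => cat j = h)).card ≤ k h := by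
      rw [add_mul] at h3
      omega
    have h5 := Nat.mul_le_mul_left N h4
    omega
  have hUval : ∀ i, ((1 : ℕ) : ℝ) * ∑ j ∈ S \ U, w i j ≤ (N : ℝ) * ∑ j ∈ U, w i j := by
    intro i
    refine mul_sum_le_mul_sum_of_categories (w i) (hw i) cat (S \ U) U 1 N (fun h => ?_)
      fun x hx y hy hxy => hanti i y x hxy.symm (hU y hy x hx hxy.symm)
    have h1 := card_filter_sdiff_add (fun j => cat j = h) hUS
    have h2 := hUc h
    have h3 := hcard h
    rw [add_mul] at h3
    rcases min_cases (S.filter (fun j => cat j = h)).card (k h) with ⟨h4, h5⟩ | ⟨h4, h5⟩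
    · rw [h4] at h2
      have : ((S \ U).filter (fun j => cat j = h)).card = 0 := by omega
      simp [this]
    · rw [h4] at h2
      rw [h2] at h1 ⊢
      omega
  by_cases hLbig : ∃ i ∈ T, 1 / 2 ≤ ∑ j ∈ L, w i j
  · obtain ⟨i, hi, hiL⟩ := hLbig
    refine ⟨L, hLS, i, hi, fun h => ?_, fun h => ?_, hiL, fun i' hi' _ => ?_⟩
    · have := hcard h
      rw [hLc h]
      rw [add_mul] at this
      omega
    · have h1 := card_filter_sdiff_add (fun j => cat j = h) hLS
      have h2 := hLc h
      omega
    · have h1 := hLval i'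
      have h2 := hsplit i' L hLS
      have h3 := hval i' hi'
      have hN : (0 : ℝ) ≤ N := Nat.cast_nonneg N
      push_cast at h1
      by_contra hlt
      push Not at hlt
      nlinarith
  push Not at hLbig
  let good : Finset (Finset M) := S.powerset.filter fun B =>
    (∀ h, (S.filter (fun j => cat j = h)).card - N * k h ≤ (B.filter (fun j => cat j = h)).card ∧
      (B.filter (fun j => cat j = h)).card ≤ k h) ∧ ∀ i ∈ T, ∑ j ∈ B, w i j < 1 / 2
  have hgood : good.Nonempty := by
    refine ⟨L, mem_filter.2 ⟨mem_powerset.2 hLS, fun h => ?_, hLbig⟩⟩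
    have := hcard h
    rw [hLc h]
    rw [add_mul] at this
    omega
  obtain ⟨B, hB, hmin⟩ := exists_min_image good (fun B => (U \ B).card) hgood
  simp only [good, mem_filter, mem_powerset] at hB
  obtain ⟨hBS, hBc, hBsmall⟩ := hB
  obtain ⟨x, hx⟩ : (U \ B).Nonempty := by
    rw [sdiff_nonempty]
    intro hUB
    obtain ⟨i, hi⟩ := hT
    have h1 := hUval i
    have h2 := hsplit i U hUS
    have h3 := hval i hi
    have h4 := hBsmall i hi
    have h5 : ∑ j ∈ U, w i j ≤ ∑ j ∈ B, w i j :=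
      sum_le_sum_of_subset_of_nonneg hUB fun j _ _ => hw i j
    have hN : (0 : ℝ) ≤ N := Nat.cast_nonneg N
    push_cast at h1
    nlinarith
  obtain ⟨hxU, hxB⟩ := mem_sdiff.1 hx
  obtain ⟨D, hDB, hDU, hDc⟩ : ∃ D ⊆ B, U \ D = U \ B ∧
      ∀ h, (S.filter (fun j => cat j = h)).card - N * k h ≤
        ((insert x D).filter (fun j => cat j = h)).card ∧
        ((insert x D).filter (fun j => cat j = h)).card ≤ k h := by
    by_cases hlt : (B.filter (fun j => cat j = cat x)).card < k (cat x)
    · refine ⟨B, Subset.rfl, rfl, fun h => ?_⟩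
      have h1 := hBc h
      rw [filter_insert]
      split_ifs with hh
      · subst hh
        rw [card_insert_of_notMem (by simp [hxB])]
        omega
      · exact h1
    · obtain ⟨y, hyB, hyU⟩ : ∃ y ∈ B.filter (fun j => cat j = cat x),
          y ∉ U.filter (fun j => cat j = cat x) := by
        by_contra! hsub
        have hx' : x ∈ U.filter (fun j => cat j = cat x) := by simp [hxU]
        have h1 := card_lt_card (s := B.filter (fun j => cat j = cat x))
          (t := U.filter (fun j => cat j = cat x))
          ⟨hsub, fun hsup => hxB (mem_filter.1 (hsup hx')).1⟩
        have h2 := hUc (cat x)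
        omega
      obtain ⟨hyB, hyx⟩ := mem_filter.1 hyB
      have hyU' : y ∉ U := fun h => hyU (mem_filter.2 ⟨h, hyx⟩)
      refine ⟨B.erase y, erase_subset _ _, ?_, fun h => ?_⟩
      · ext j
        simp only [mem_sdiff, mem_erase]
        have : j ∈ U → j ≠ y := fun h1 h2 => hyU' (h2 ▸ h1)
        tauto
      · have h1 := hBc h
        rw [filter_insert, filter_erase]
        split_ifs with hh
        · subst hh
          rw [card_insert_of_notMem (by simp [hxB]),
            card_erase_add_one (mem_filter.2 ⟨hyB, hyx⟩)]
          exact h1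
        · rw [erase_eq_of_notMem (by simp [hyx, hh])]
          exact h1
  have hxD : x ∉ D := fun h => hxB (hDB h)
  have hinsS : insert x D ⊆ S := insert_subset (hUS hxU) (hDB.trans hBS)
  obtain ⟨i, hi, hiD⟩ : ∃ i ∈ T, 1 / 2 ≤ ∑ j ∈ insert x D, w i j := by
    by_contra! hno
    have h1 := hmin (insert x D) (mem_filter.2 ⟨mem_powerset.2 hinsS, hDc, hno⟩)
    rw [sdiff_insert, hDU] at h1
    exact absurd h1 (not_le.2 (card_erase_lt_of_mem hx))
  refine ⟨insert x D, hinsS, i, hi, fun h => (hDc h).2, fun h => ?_, hiD, fun i' hi' _ => ?_⟩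
  · have h1 := card_filter_sdiff_add (fun j => cat j = h) hinsS
    have h2 := hDc h
    omega
  · have h1 := hsplit i' _ hinsS
    have h2 := hval i' hi'
    have h3 := hBsmall i' hi'
    have h4 := hsmall i' x
    have h5 : ∑ j ∈ D, w i' j ≤ ∑ j ∈ B, w i' j :=
      sum_le_sum_of_subset_of_nonneg hDB fun j _ _ => hw i' j
    rw [sum_insert hxD] at h1
    linarith

/-- In an ordered instance every agent can receive a feasible bundle worth at least `1 / 2`. -/
theorem exists_owner_of_ordered {M ι : Type*} [LinearOrder M] [DecidableEq ι] [Nonempty ι] {ℓ : ℕ}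
    (cat : M → Fin ℓ) (k : Fin ℓ → ℕ)
    (w : ι → M → ℝ) (hw : ∀ i j, 0 ≤ w i j) (hsmall : ∀ i j, w i j < 1 / 2)
    (hanti : ∀ i x y, cat x = cat y → x ≤ y → w i y ≤ w i x)
    (N : ℕ) (T : Finset ι) (hTN : T.card = N) (S : Finset M)
    (hcard : ∀ h, (S.filter (fun j => cat j = h)).card ≤ N * k h)
    (hval : ∀ i ∈ T, (N : ℝ) ≤ ∑ j ∈ S, w i j) :
    ∃ o : M → ι, (∀ j ∈ S, o j ∈ T) ∧ ∀ i ∈ T,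
      FeasibleBundle cat k (S.filter (fun j => o j = i)) ∧
      1 / 2 ≤ ∑ j ∈ S.filter (fun j => o j = i), w i j := by
  induction N generalizing T S with
  | zero =>
    have hT : T = ∅ := card_eq_zero.1 hTN
    refine ⟨fun _ => Classical.arbitrary ι, fun j hj => ?_, by simp [hT]⟩
    have h1 := hcard (cat j)
    have h2 : j ∈ S.filter (fun x => cat x = cat j) := by simp [hj]
    have := card_pos.2 ⟨j, h2⟩
    omega
  | succ N ih =>
    obtain ⟨B, hBS, i, hi, hfeas, hrest, hiB, hothers⟩ := exists_bag cat k w hw hsmall hanti T N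
      (card_pos.1 (by omega)) S hcard (fun i hi => by exact_mod_cast hval i hi)
    obtain ⟨o, hoT, ho⟩ := ih (T.erase i) (by rw [card_erase_of_mem hi]; omega) (S \ B) hrest
      (fun i' hi' => hothers i' (mem_of_mem_erase hi') (ne_of_mem_erase hi'))
    refine ⟨fun j => if j ∈ B then i else o j, fun j hj => ?_, fun i' hi' => ?_⟩
    · simp only
      split_ifs with hjB
      · exact hi
      · exact mem_of_mem_erase (hoT j (mem_sdiff.2 ⟨hj, hjB⟩))
    · by_cases hii : i' = i
      · subst hii
        have : S.filter (fun j => (if j ∈ B then i' else o j) = i') = B := by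
          ext j
          simp only [mem_filter]
          constructor
          · rintro ⟨hj, h⟩
            by_contra hjB
            rw [if_neg hjB] at h
            exact ne_of_mem_erase (hoT j (mem_sdiff.2 ⟨hj, hjB⟩)) h
          · intro hj
            exact ⟨hBS hj, if_pos hj⟩
        rw [this]
        exact ⟨hfeas, hiB⟩
      · have : S.filter (fun j => (if j ∈ B then i else o j) = i') =
            (S \ B).filter (fun j => o j = i') := by
          ext j
          simp only [mem_filter, mem_sdiff]
          by_cases hjB : j ∈ B
          · simp [hjB, Ne.symm hii]
          · simp [hjB]
        rw [this]
        exact ho i' (mem_erase.2 ⟨hii, hi'⟩)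

/-- Sorting the items by category and, within each category, by decreasing value. -/
theorem exists_sorting_perm {m ℓ : ℕ} (cat : Fin m → Fin ℓ) (v : Fin m → ℝ) :
    ∃ τ : Equiv.Perm (Fin m), cat ∘ τ = cat ∘ Tuple.sort cat ∧
      ∀ x y, cat (τ x) = cat (τ y) → x ≤ y → v (τ y) ≤ v (τ x) := by
  let f : Fin m → Fin ℓ ×ₗ ℝ := fun j => toLex (cat j, -v j)
  have hf := Tuple.monotone_sort f
  refine ⟨Tuple.sort f, Tuple.unique_monotone (fun x y hxy => ?_) (Tuple.monotone_sort cat), ?_⟩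
  · rcases Prod.Lex.le_iff.1 (hf hxy) with h | h
    · exact h.le
    · exact h.1.le
  · intro x y hxy hle
    rcases Prod.Lex.le_iff.1 (hf hle) with h | h
    · exact absurd hxy h.ne
    · exact neg_le_neg_iff.1 h.2

/-- Reduction from ordered instances: if every position `p` is owned by `o p`, then items can be
assigned to positions within each category so that every owner gets an item worth at least
the position's value. -/
theorem exists_perm_of_owner {m ℓ : ℕ} {ι : Type*} (cat cat' : Fin m → Fin ℓ)
    (v : ι → Fin m → ℝ) (τ : ι → Equiv.Perm (Fin m)) (hτ : ∀ i p, cat (τ i p) = cat' p)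
    (hanti : ∀ i x y, cat' x = cat' y → x ≤ y → v i (τ i y) ≤ v i (τ i x))
    (o : Fin m → ι) :
    ∃ σ : Equiv.Perm (Fin m), (∀ p, cat (σ p) = cat' p) ∧
      ∀ p, v (o p) (τ (o p) p) ≤ v (o p) (σ p) := by
  classical
  let t : Fin m → Finset (Fin m) := fun p =>
    univ.filter fun x => cat x = cat' p ∧ v (o p) (τ (o p) p) ≤ v (o p) x
  obtain ⟨σ, hσ, hσt⟩ := (all_card_le_biUnion_card_iff_exists_injective t).1 (by
    intro s
    rw [card_eq_sum_card_fiberwise (f := cat') (t := univ) (by simp),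
      card_eq_sum_card_fiberwise (f := cat) (s := s.biUnion t) (t := univ) (by simp)]
    refine sum_le_sum fun h _ => ?_
    rcases (s.filter (fun p => cat' p = h)).eq_empty_or_nonempty with he | hne
    · simp [he]
    obtain ⟨p, hp, hmax⟩ := exists_max_image _ id hne
    obtain ⟨hps, hph⟩ := mem_filter.1 hp
    refine card_le_card_of_injOn (τ (o p)) (fun q hq => ?_) (τ (o p)).injective.injOn
    obtain ⟨hqs, hqh⟩ := mem_filter.1 (mem_coe.1 hq)
    have hqp : cat' q = cat' p := hqh.trans hph.symm
    refine mem_coe.2 (mem_filter.2 ⟨mem_biUnion.2 ⟨p, hps, mem_filter.2 ⟨mem_univ _, ?_, ?_⟩⟩, ?_⟩)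
    · rw [hτ, hqp]
    · exact hanti _ q p hqp (hmax q (mem_coe.1 hq))
    · rw [hτ, hqh])
  refine ⟨Equiv.ofBijective σ (Finite.injective_iff_bijective.1 hσ), fun p => ?_, fun p => ?_⟩
  · exact (mem_filter.1 (hσt p)).2.1
  · exact (mem_filter.1 (hσt p)).2.2

/-- In a normalized instance (`v i (M) = n` for every agent) in which
every item is worth less than 1/2 to every agent, there is a feasible allocation
giving every agent a bundle worth at least 1/2. -/
theorem stmt_15 {m ℓ n : ℕ} (hn : 1 ≤ n)
    (cat : Fin m → Fin ℓ) (k : Fin ℓ → ℕ)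
    (hcard : ∀ h, (univ.filter (fun x => cat x = h)).card ≤ n * k h)
    (v : Fin n → Fin m → ℝ) (hv : ∀ i j, 0 ≤ v i j)
    (hnorm : ∀ i, ∑ j, v i j = (n : ℝ))
    (hsmall : ∀ i j, v i j < 1 / 2) :
    ∃ A : Fin n → Finset (Fin m), FeasibleAlloc cat k A ∧
      ∀ i, 1 / 2 ≤ ∑ j ∈ A i, v i j := by
  have : Nonempty (Fin n) := ⟨⟨0, hn⟩⟩
  choose τ hτ hanti using fun i => exists_sorting_perm cat (v i)
  have hτ' : ∀ i p, cat (τ i p) = (cat ∘ Tuple.sort cat) p := fun i p => congrFun (hτ i) p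
  have hanti' : ∀ i x y, (cat ∘ Tuple.sort cat) x = (cat ∘ Tuple.sort cat) y → x ≤ y →
      v i (τ i y) ≤ v i (τ i x) :=
    fun i x y hxy => hanti i x y ((hτ' i x).trans (hxy.trans (hτ' i y).symm))
  obtain ⟨o, -, ho⟩ := exists_owner_of_ordered (cat ∘ Tuple.sort cat) k (fun i p => v i (τ i p))
    (fun i p => hv i _) (fun i p => hsmall i _) hanti' n univ (by simp) univ
    (fun h => by
      refine le_trans (le_of_eq ?_) (hcard h)
      exact card_equiv (Tuple.sort cat) (by simp))
    (fun i _ => by rw [Equiv.sum_comp (τ i) (v i), hnorm])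
  obtain ⟨σ, hσ, hσv⟩ := exists_perm_of_owner cat (cat ∘ Tuple.sort cat) v τ hτ' hanti' o
  refine ⟨fun i => (univ.filter (fun p => o p = i)).map σ.toEmbedding, ⟨?_, ?_⟩, ?_⟩
  · intro j
    refine ⟨o (σ.symm j), by simp, ?_⟩
    intro i hi
    obtain ⟨p, hp, rfl⟩ := mem_map.1 hi
    simpa using (mem_filter.1 hp).2.symm
  · intro i h
    rw [filter_map, card_map]
    refine le_trans (le_of_eq ?_) ((ho i (mem_univ i)).1 h)
    congr 1
    refine filter_congr fun p _ => ?_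
    simp only [Function.comp_apply, Equiv.toEmbedding_apply] at hσ ⊢
    rw [hσ]
  · intro i
    rw [sum_map]
    refine (ho i (mem_univ i)).2.trans (sum_le_sum fun p hp => ?_)
    obtain rfl := (mem_filter.1 hp).2
    exact hσv p
end
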